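/- The elementary deformation (G', 𝒥) of (G, 𝒥) by X₀ and f is a generalized almost Hermitian structure on V: G' is a positive-definite symmetric bilinear form on W with G'(𝒥u, 𝒥v) = G'(u, v), the endomorphism (G')^end determined by G'(u, v) = ⟨(G')^end u, v⟩ satisfies ((G')^end)² = Id, and moreover (G')^end = τ ∘ G^end ∘ τ⁻¹, so that the second structure of (G', 𝒥) is (G')^end ∘ 𝒥 = 𝒥₂' = τ ∘ 𝒥₂ ∘ τ⁻¹. -/

import Mathlib

open Module

/-- The generalized tangent space `W = V ⊕ V*`. -/
abbrev GT (V : Type*) [AddCommGroup V] [Module ℝ V] := V × Module.Dual ℝ V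

/-- The canonical symmetric pairing on `W = V ⊕ V*`. -/
noncomputable def gpair {V : Type*} [AddCommGroup V] [Module ℝ V] (u v : GT V) : ℝ :=
  (1 / 2) * (v.2 u.1 + u.2 v.1)

/-- A generalized almost complex structure on `V`. -/
def IsGacs {V : Type*} [AddCommGroup V] [Module ℝ V] (J : GT V →ₗ[ℝ] GT V) : Prop :=
  (∀ u, J (J u) = -u) ∧ (∀ u v, gpair (J u) v = - gpair u (J v))

/-- A generalized almost Hermitian structure on `V`. -/
structure IsGah {V : Type*} [AddCommGroup V] [Module ℝ V]
    (G : GT V →ₗ[ℝ] GT V →ₗ[ℝ] ℝ) (J Gend : GT V →ₗ[ℝ] GT V) : Prop where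
  gacs : IsGacs J
  symm : ∀ u v, G u v = G v u
  posdef : ∀ u, u ≠ 0 → 0 < G u u
  hermitian : ∀ u v, G (J u) (J v) = G u v
  gend_pair : ∀ u v, G u v = gpair (Gend u) v
  gend_sq : ∀ u, Gend (Gend u) = u

section GeneralizedPairing

variable {V : Type*} [AddCommGroup V] [Module ℝ V]

theorem gpair_comm (u v : GT V) : gpair u v = gpair v u := by
  simp only [gpair]; ring

theorem gpair_add_left (u v w : GT V) : gpair (u + v) w = gpair u w + gpair v w := by
  simp only [gpair, Prod.fst_add, Prod.snd_add, map_add, LinearMap.add_apply]; ring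

theorem gpair_smul_left (c : ℝ) (u w : GT V) : gpair (c • u) w = c * gpair u w := by
  simp only [gpair, Prod.smul_fst, Prod.smul_snd, map_smul, LinearMap.smul_apply, smul_eq_mul]
  ring

theorem gpair_neg_left (u w : GT V) : gpair (-u) w = -gpair u w := by
  rw [← neg_one_smul ℝ u, gpair_smul_left, neg_one_mul]

theorem gpair_sub_left (u v w : GT V) : gpair (u - v) w = gpair u w - gpair v w := by
  rw [sub_eq_add_neg, gpair_add_left, gpair_neg_left, sub_eq_add_neg]

theorem gpair_add_right (w u v : GT V) : gpair w (u + v) = gpair w u + gpair w v := by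
  simp only [gpair_comm w, gpair_add_left]

theorem gpair_smul_right (c : ℝ) (w u : GT V) : gpair w (c • u) = c * gpair w u := by
  simp only [gpair_comm w, gpair_smul_left]

theorem gpair_neg_right (w u : GT V) : gpair w (-u) = -gpair w u := by
  simp only [gpair_comm w, gpair_neg_left]

theorem gpair_zero_right (w : GT V) : gpair w 0 = 0 := by
  simp [gpair]

theorem gpair_left_injective {u v : GT V} (h : ∀ w, gpair u w = gpair v w) : u = v := by
  refine Prod.ext ?_ (LinearMap.ext fun x => ?_)
  · refine (Module.forall_dual_apply_eq_zero_iff ℝ (u.1 - v.1)).1 (fun φ => ?_) |> sub_eq_zero.1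
    have := h (0, φ)
    simp only [gpair, map_zero, add_zero] at this
    rw [map_sub]; linarith
  · have := h (x, 0)
    simp only [gpair, LinearMap.zero_apply, zero_add] at this
    linarith

/-- A vector pairing to zero with a spanning set pairs to zero with its span. -/
theorem gpair_eq_zero_of_mem_span {w : GT V} {A : Set (GT V)} (h : ∀ s ∈ A, gpair w s = 0)
    {s : GT V} (hs : s ∈ Submodule.span ℝ A) : gpair w s = 0 := by
  induction hs using Submodule.span_induction with
  | mem x hx => exact h x hx
  | zero => exact gpair_zero_right w
  | add x y _ _ hx hy => rw [gpair_add_right, hx, hy, add_zero]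
  | smul c x _ hx => rw [gpair_smul_right, hx, mul_zero]

namespace IsGah

variable {G : GT V →ₗ[ℝ] GT V →ₗ[ℝ] ℝ} {J Gend : GT V →ₗ[ℝ] GT V}

theorem gpair_gend_left (h : IsGah G J Gend) (u v : GT V) :
    gpair (Gend u) v = gpair u (Gend v) := by
  rw [← h.gend_pair, h.symm, h.gend_pair, gpair_comm]

theorem commute (h : IsGah G J Gend) (u : GT V) : J (Gend u) = Gend (J u) := by
  refine gpair_left_injective fun w => ?_
  have h₁ := h.hermitian u (J w)
  rw [h.gend_pair, h.gend_pair, h.gacs.1, gpair_neg_right] at h₁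
  rw [h.gacs.2, ← h₁, neg_neg]

end IsGah

end GeneralizedPairing

/-- let `(G, 𝒥)` be a generalized almost Hermitian structure, `X₀ ∈ V`
nonzero, `f ≠ 0`, and let `τ` be the automorphism of `W` equal to the identity on
`S^⊥` (orthogonal complement of `S = span{X₀,𝒥₁X₀,𝒥₂X₀,𝒥₃X₀}` for the canonical
pairing) and scaling the basis of `S` by `f, f, 1/f, 1/f`. Then the elementary
deformation `(G', 𝒥)` with `G'(u,v) = G(τ⁻¹u, τ⁻¹v)` is a generalized almost Hermitian
structure with associated endomorphism `(G')^end = τ ∘ G^end ∘ τ⁻¹`, and its second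
structure is `(G')^end ∘ 𝒥 = τ ∘ 𝒥₂ ∘ τ⁻¹`. -/
theorem statement9 {V : Type*} [AddCommGroup V] [Module ℝ V] [FiniteDimensional ℝ V]
    (G : GT V →ₗ[ℝ] GT V →ₗ[ℝ] ℝ) (J Gend : GT V →ₗ[ℝ] GT V)
    (hGah : IsGah G J Gend) (X₀ : V) (hX₀ : X₀ ≠ 0) (f : ℝ) (hf : f ≠ 0)
    (τ : GT V ≃ₗ[ℝ] GT V)
    (hτperp : ∀ w : GT V,
      (∀ s ∈ Submodule.span ℝ {((X₀, 0) : GT V), J (X₀, 0), (Gend ∘ₗ J) (X₀, 0),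
          (J ∘ₗ Gend ∘ₗ J) (X₀, 0)}, gpair w s = 0) → τ w = w)
    (hτ0 : τ ((X₀, 0) : GT V) = f • ((X₀, 0) : GT V))
    (hτ1 : τ (J (X₀, 0)) = f • J (X₀, 0))
    (hτ2 : τ ((Gend ∘ₗ J) (X₀, 0)) = f⁻¹ • (Gend ∘ₗ J) (X₀, 0))
    (hτ3 : τ ((J ∘ₗ Gend ∘ₗ J) (X₀, 0)) = f⁻¹ • (J ∘ₗ Gend ∘ₗ J) (X₀, 0)) :
    IsGah (G.compl₁₂ τ.symm.toLinearMap τ.symm.toLinearMap) J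
        (τ.toLinearMap ∘ₗ Gend ∘ₗ τ.symm.toLinearMap) ∧
    (τ.toLinearMap ∘ₗ Gend ∘ₗ τ.symm.toLinearMap) ∘ₗ J =
      τ.toLinearMap ∘ₗ (Gend ∘ₗ J) ∘ₗ τ.symm.toLinearMap := by
  obtain ⟨hJJ, hJs⟩ := hGah.gacs
  set e₀ : GT V := (X₀, 0) with he₀
  set e₁ := J e₀ with he₁
  set e₂ := (Gend ∘ₗ J) e₀ with he₂
  set e₃ := (J ∘ₗ Gend ∘ₗ J) e₀ with he₃
  have hJ1 : J e₁ = -e₀ := hJJ e₀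
  have hJ2 : J e₂ = e₃ := rfl
  have hJ3 : J e₃ = -e₂ := hJJ e₂
  have hG1 : Gend e₁ = e₂ := rfl
  have hG2 : Gend e₂ = e₁ := hGah.gend_sq e₁
  have hG3 : e₃ = -Gend e₀ := by rw [← hJ2, ← hG1, hGah.commute, hJ1, map_neg]
  have p00 : gpair e₀ e₀ = 0 := by simp [gpair, he₀]
  have p01 : gpair e₀ e₁ = 0 := by
    have := hJs e₀ e₀
    rw [gpair_comm] at this; linarith
  have p11 : gpair e₁ e₁ = 0 := by
    rw [he₁, hJs, ← he₁, hJ1, gpair_neg_right, p00]; simp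
  have p02 : gpair e₀ e₂ = 0 := by
    have h₁ := hJs e₀ (Gend e₀)
    rw [hGah.commute, ← hGah.gpair_gend_left, ← he₁, hG1, gpair_comm] at h₁
    have h₂ : gpair e₀ (Gend e₁) = gpair e₀ e₂ := by rw [hG1]
    linarith
  have p12 : gpair e₁ e₂ = G e₀ e₀ := by
    rw [← hG1, ← hGah.gpair_gend_left, ← hGah.gend_pair, hGah.hermitian]
  have p03 : gpair e₀ e₃ = -G e₀ e₀ := by
    rw [hG3, gpair_neg_right, ← hGah.gpair_gend_left, ← hGah.gend_pair]
  have p13 : gpair e₁ e₃ = 0 := by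
    rw [hG3, gpair_neg_right, ← hGah.gpair_gend_left, hG1, gpair_comm, p02, neg_zero]
  have p22 : gpair e₂ e₂ = 0 := by
    rw [← hG1, hGah.gpair_gend_left, hGah.gend_sq, p11]
  have p23 : gpair e₂ e₃ = 0 := by
    rw [hG3, gpair_neg_right, ← hGah.gpair_gend_left, hG2, gpair_comm, p01, neg_zero]
  have p33 : gpair e₃ e₃ = 0 := by
    rw [hG3, gpair_neg_right, gpair_neg_left, hGah.gpair_gend_left, hGah.gend_sq, p00]; simp
  have ha : 0 < G e₀ e₀ := hGah.posdef _ fun h => hX₀ (congrArg Prod.fst h)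
  set a := G e₀ e₀
  have p10 : gpair e₁ e₀ = 0 := by rw [gpair_comm, p01]
  have p20 : gpair e₂ e₀ = 0 := by rw [gpair_comm, p02]
  have p30 : gpair e₃ e₀ = -a := by rw [gpair_comm, p03]
  have p21 : gpair e₂ e₁ = a := by rw [gpair_comm, p12]
  have p31 : gpair e₃ e₁ = 0 := by rw [gpair_comm, p13]
  have p32 : gpair e₃ e₂ = 0 := by rw [gpair_comm, p23]
  have ha0 : a ≠ 0 := ha.ne'
  have hτ (w : GT V) : τ w = w + ((f - 1) * (-gpair w e₃ / a)) • e₀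
      + ((f - 1) * (gpair w e₂ / a)) • e₁ + ((f⁻¹ - 1) * (gpair w e₁ / a)) • e₂
      + ((f⁻¹ - 1) * (-gpair w e₀ / a)) • e₃ := by
    have key := hτperp (w - ((-gpair w e₃ / a) • e₀ + (gpair w e₂ / a) • e₁
      + (gpair w e₁ / a) • e₂ + (-gpair w e₀ / a) • e₃)) fun s hs => by
        refine gpair_eq_zero_of_mem_span ?_ hs
        rintro s (rfl | rfl | rfl | rfl) <;>
        · simp only [gpair_sub_left, gpair_add_left, gpair_smul_left, p00, p01, p02, p03, p10,
            p11, p12, p13, p20, p21, p22, p23, p30, p31, p32, p33]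
          field_simp
          ring
    simp only [map_sub, map_add, map_smul, hτ0, hτ1, hτ2, hτ3] at key
    rw [sub_eq_iff_eq_add] at key
    rw [key]
    module
  have hτJ (w : GT V) : τ (J w) = J (τ w) := by
    rw [hτ, hτ]
    simp only [map_add, map_smul, ← he₁, hJ1, hJ2, hJ3, hJs, gpair_neg_right]
    module
  have hτiso (u v : GT V) : gpair (τ u) (τ v) = gpair u v := by
    rw [hτ, hτ]
    simp only [gpair_add_left, gpair_smul_left, gpair_add_right, gpair_smul_right, p00, p01, p02,
      p03, p10, p11, p12, p13, p20, p21, p22, p23, p30, p31, p32, p33, gpair_comm _ v]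
    field_simp
    ring
  have hτJ' (w : GT V) : τ.symm (J w) = J (τ.symm w) := by
    rw [LinearEquiv.symm_apply_eq, hτJ, LinearEquiv.apply_symm_apply]
  refine ⟨⟨hGah.gacs, fun u v => hGah.symm _ _, fun u hu => hGah.posdef _ (by simpa using hu),
    fun u v => ?_, fun u v => ?_, fun u => ?_⟩, LinearMap.ext fun u => ?_⟩
  · simp [hτJ', hGah.hermitian]
  · have := hτiso (Gend (τ.symm u)) (τ.symm v)
    rw [LinearEquiv.apply_symm_apply] at this
    simpa [hGah.gend_pair] using this.symm
  · simp [hGah.gend_sq]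
  · simp [hτJ']
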